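/- A finite sequence of integers is an η-sequence if and only if it belongs to 𝒜⁺. -/

import Mathlib

/-- The matrix `η(x) = [[x, -1], [1, 0]]`. -/
def eta (x : ℤ) : Matrix (Fin 2) (Fin 2) ℤ :=
  !![x, -1; 1, 0]

/-- η-sequences: generated from `(1,1,1)` by cyclic shifts, reversal and the
insertion rule `(c₁, c₂, c₃, …) ↦ (c₁+1, 1, c₂+1, c₃, …)`. -/
inductive IsEtaSeq : List ℤ → Prop
  | base : IsEtaSeq [1, 1, 1]
  | shift (c : ℤ) (l : List ℤ) : IsEtaSeq (c :: l) → IsEtaSeq (l ++ [c])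
  | reverse (l : List ℤ) : IsEtaSeq l → IsEtaSeq l.reverse
  | insert (c₁ c₂ : ℤ) (l : List ℤ) : IsEtaSeq (c₁ :: c₂ :: l) →
      IsEtaSeq ((c₁ + 1) :: 1 :: (c₂ + 1) :: l)

/-- The set `𝒜⁺`: nonempty finite sequences `(c_1,…,c_n)` of integers with all
entries `≥ 1`, with `η(c_1)⋯η(c_n) = -Id`, and such that for every `i < n` both
entries of the first column of the partial product `η(c_1)⋯η(c_i)` are nonnegative. -/
def APlus (l : List ℤ) : Prop :=
  l ≠ [] ∧ (∀ x ∈ l, 1 ≤ x) ∧ (l.map eta).prod = -1 ∧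
    ∀ i < l.length,
      0 ≤ ((l.take i).map eta).prod 0 0 ∧ 0 ≤ ((l.take i).map eta).prod 1 0

lemma eta_mul_apply_zero_zero (c : ℤ) (N : Matrix (Fin 2) (Fin 2) ℤ) :
    (eta c * N) 0 0 = c * N 0 0 - N 1 0 := by
  simp [eta, Matrix.mul_apply, Fin.sum_univ_two, sub_eq_add_neg]

lemma eta_mul_apply_one (c : ℤ) (N : Matrix (Fin 2) (Fin 2) ℤ) (j : Fin 2) :
    (eta c * N) 1 j = N 0 j := by
  simp [eta, Matrix.mul_apply, Fin.sum_univ_two]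

lemma mul_eta_apply_zero (N : Matrix (Fin 2) (Fin 2) ℤ) (c : ℤ) (i : Fin 2) :
    (N * eta c) i 0 = N i 0 * c + N i 1 := by
  simp [eta, Matrix.mul_apply, Fin.sum_univ_two]

lemma mul_eta_apply_one (N : Matrix (Fin 2) (Fin 2) ℤ) (c : ℤ) (i : Fin 2) :
    (N * eta c) i 1 = -N i 0 := by
  simp [eta, Matrix.mul_apply, Fin.sum_univ_two]

lemma eta_add_one_mul_eta_one_mul (a b : ℤ) :
    eta (a + 1) * (eta 1 * eta (b + 1)) = eta a * eta b := by
  ext i j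
  fin_cases i <;> fin_cases j <;> simp [eta, Matrix.mul_apply, Fin.sum_univ_two] <;> ring

lemma prod_map_eta_insert (a b : ℤ) (s : List ℤ) :
    (((a + 1) :: 1 :: (b + 1) :: s).map eta).prod = ((a :: b :: s).map eta).prod := by
  simp only [List.map_cons, List.prod_cons]
  rw [← mul_assoc (eta a), ← eta_add_one_mul_eta_one_mul]
  simp only [mul_assoc]

lemma det_prod_map_eta (l : List ℤ) : (l.map eta).prod.det = 1 := by
  induction l with
  | nil => simp
  | cons c l ih =>
    rw [List.map_cons, List.prod_cons, Matrix.det_mul, ih]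
    simp [eta, Matrix.det_fin_two]

lemma det_entries_prod_map_eta (l : List ℤ) :
    (l.map eta).prod 0 0 * (l.map eta).prod 1 1 -
      (l.map eta).prod 0 1 * (l.map eta).prod 1 0 = 1 := by
  rw [← Matrix.det_fin_two, det_prod_map_eta]

lemma prod_map_eta_take_succ (l : List ℤ) {i : ℕ} (hi : i < l.length) :
    ((l.take (i + 1)).map eta).prod = ((l.take i).map eta).prod * eta l[i] := by
  rw [List.take_succ_eq_append_getElem hi, List.map_append, List.prod_append, List.map_singleton,
    List.prod_singleton]

lemma prod_map_eta_reverse (l : List ℤ) :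
    (l.reverse.map eta).prod =
      !![(l.map eta).prod 0 0, -(l.map eta).prod 1 0;
        -(l.map eta).prod 0 1, (l.map eta).prod 1 1] := by
  induction l with
  | nil => ext i j; fin_cases i <;> fin_cases j <;> simp
  | cons c l ih =>
    rw [List.reverse_cons, List.map_append, List.prod_append, ih]
    ext i j
    fin_cases i <;> fin_cases j <;>
      simp [eta, Matrix.mul_apply, Fin.sum_univ_two] <;> ring

lemma APlus.shift {c : ℤ} {l : List ℤ} (h : APlus (c :: l)) : APlus (l ++ [c]) := by
  obtain ⟨-, hpos, hprod, hnn⟩ := h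
  rw [List.map_cons, List.prod_cons] at hprod
  have hz : ∀ i < l.length, 0 ≤ ((l.take i).map eta).prod 0 0 := fun i hi => by
    have := (hnn (i + 1) (by simpa using hi)).2
    rwa [List.take_succ_cons, List.map_cons, List.prod_cons, eta_mul_apply_one] at this
  have ho : ∀ i < l.length, 0 ≤ ((l.take i).map eta).prod 1 0 := by
    intro i
    induction i with
    | zero => simp
    | succ i ih =>
      intro hi
      have h0 := hz i (by omega)
      have h1 := hz (i + 1) hi
      have h2 := ih (by omega)
      have hd := det_entries_prod_map_eta (l.take i)
      rw [prod_map_eta_take_succ l (by omega), mul_eta_apply_zero] at h1 ⊢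
      set N := ((l.take i).map eta).prod
      have key : N 0 0 * (N 1 0 * l[i] + N 1 1) =
          1 + N 1 0 * (N 0 0 * l[i] + N 0 1) := by linear_combination hd
      by_contra! hneg
      nlinarith [mul_nonneg h2 h1]
  refine ⟨by simp, fun x hx => hpos x (by simpa [or_comm] using hx), ?_, fun i hi => ?_⟩
  · have h1 : eta c * -(l.map eta).prod = 1 := by rw [mul_neg, hprod, neg_neg]
    have h2 := mul_eq_one_comm.mp h1
    rw [neg_mul] at h2
    simpa using neg_eq_iff_eq_neg.mp h2
  · have hi' : i ≤ l.length := by simpa [Nat.lt_succ_iff] using hi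
    rw [List.take_append_of_le_length hi']
    rcases hi'.lt_or_eq with hlt | rfl
    · exact ⟨hz i hlt, ho i hlt⟩
    · have h00 := congrFun (congrFun hprod 0) 0
      have h10 := congrFun (congrFun hprod 1) 0
      rw [eta_mul_apply_zero_zero] at h00
      rw [eta_mul_apply_one] at h10
      simp only [Matrix.neg_apply, Matrix.one_apply_eq, Matrix.one_apply_ne one_ne_zero,
        neg_zero] at h00 h10
      rw [List.take_length]
      rw [h10] at h00 ⊢
      constructor <;> linarith

lemma APlus.reverse {l : List ℤ} (h : APlus l) : APlus l.reverse := by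
  obtain ⟨hne, hpos, hprod, hnn⟩ := h
  refine ⟨by simpa using hne, fun x hx => hpos x (by simpa using hx), ?_, fun i hi => ?_⟩
  · rw [prod_map_eta_reverse, hprod]
    ext i j
    fin_cases i <;> fin_cases j <;> simp
  · rw [List.length_reverse] at hi
    obtain ⟨k, hk⟩ : ∃ k, l.length - i = k + 1 := ⟨l.length - i - 1, by omega⟩
    have hkl : k < l.length := by omega
    rw [List.take_reverse, prod_map_eta_reverse, hk]
    have hAB : ((l.take (k + 1)).map eta).prod * ((l.drop (k + 1)).map eta).prod = -1 := by
      rw [← List.prod_append, ← List.map_append, List.take_append_drop, hprod]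
    have hd := det_entries_prod_map_eta (l.take (k + 1))
    obtain ⟨h0, h1⟩ := hnn k hkl
    have e01 := mul_eta_apply_one ((l.take k).map eta).prod l[k] 0
    have e11 := mul_eta_apply_one ((l.take k).map eta).prod l[k] 1
    rw [← prod_map_eta_take_succ l hkl] at e01 e11
    set A := ((l.take (k + 1)).map eta).prod
    set B := ((l.drop (k + 1)).map eta).prod
    have h00 := congrFun (congrFun hAB 0) 0
    have h01 := congrFun (congrFun hAB 0) 1
    have h10 := congrFun (congrFun hAB 1) 0
    have h11 := congrFun (congrFun hAB 1) 1
    simp only [Matrix.mul_apply, Fin.sum_univ_two, Matrix.neg_apply, Matrix.one_apply_eq,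
      Matrix.one_apply_ne one_ne_zero, Matrix.one_apply_ne zero_ne_one, neg_zero]
      at h00 h01 h10 h11
    have hB00 : B 0 0 = -A 1 1 := by
      linear_combination A 1 1 * h00 - A 0 1 * h10 - B 0 0 * hd
    have hB01 : B 0 1 = A 0 1 := by
      linear_combination A 1 1 * h01 - A 0 1 * h11 - B 0 1 * hd
    simp only [Matrix.of_apply, Matrix.cons_val', Matrix.cons_val_zero, Matrix.cons_val_one,
      Matrix.cons_val_fin_one]
    constructor <;> linarith

lemma APlus.insert {a b : ℤ} {l : List ℤ} (h : APlus (a :: b :: l)) :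
    APlus ((a + 1) :: 1 :: (b + 1) :: l) := by
  obtain ⟨-, hpos, hprod, hnn⟩ := h
  simp only [List.mem_cons, forall_eq_or_imp] at hpos
  obtain ⟨ha, hb, hl⟩ := hpos
  refine ⟨by simp, ?_, (prod_map_eta_insert a b l).trans hprod, fun i hi => ?_⟩
  · simp only [List.mem_cons, forall_eq_or_imp]
    exact ⟨by omega, le_rfl, by omega, hl⟩
  · match i with
    | 0 => simp
    | 1 => simp [eta]; omega
    | 2 => simp [eta]; omega
    | i + 3 =>
      have := hnn (i + 2) (by simpa using hi)
      simp only [List.take_succ_cons] at this ⊢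
      rwa [prod_map_eta_insert]

lemma IsEtaSeq.aPlus {l : List ℤ} (h : IsEtaSeq l) : APlus l := by
  induction h with
  | base =>
    refine ⟨by simp, by simp, by simp [eta]; decide, fun i hi => ?_⟩
    match i, hi with
    | 0, _ => simp
    | 1, _ => simp [eta]
    | 2, _ => simp [eta]
  | shift c l _ ih => exact ih.shift
  | reverse l _ ih => exact ih.reverse
  | insert a b l _ ih => exact ih.insert

lemma List.IsRotated.induction_of_shift {p : List ℤ → Prop}
    (hp : ∀ c l, p (c :: l) → p (l ++ [c])) {l l' : List ℤ} (hl : l ~r l') (h : p l) : p l' := by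
  obtain ⟨n, rfl⟩ := hl
  induction n generalizing l with
  | zero => simpa using h
  | succ n ih =>
    cases l with
    | nil => simpa using h
    | cons c l => simpa using ih (hp c l h)

lemma prod_map_eta_of_two_le {l : List ℤ} (h : ∀ x ∈ l, 2 ≤ x) :
    0 ≤ (l.map eta).prod 1 0 ∧ (l.map eta).prod 1 0 < (l.map eta).prod 0 0 := by
  induction l with
  | nil => simp
  | cons c l ih =>
    simp only [List.mem_cons, forall_eq_or_imp] at h
    obtain ⟨h0, h1⟩ := ih h.2
    rw [List.map_cons, List.prod_cons, eta_mul_apply_zero_zero, eta_mul_apply_one]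
    constructor <;> nlinarith [h.1]

lemma APlus.one_mem {l : List ℤ} (h : APlus l) : (1 : ℤ) ∈ l := by
  by_contra hl
  have := prod_map_eta_of_two_le (l := l) fun x hx => by
    have := h.2.1 x hx
    have : x ≠ 1 := fun e => hl (e ▸ hx)
    omega
  rw [h.2.2.1] at this
  simp at this

/-- The entry `1` can be moved to the second position. -/
lemma APlus.exists_isRotated {l : List ℤ} (h : APlus l) :
    ∃ c d r, l ~r c :: 1 :: d :: r := by
  obtain ⟨s, t, rfl⟩ := List.append_of_mem h.one_mem
  have hr : s ++ 1 :: t ~r 1 :: (t ++ s) := by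
    simpa using (List.isRotated_append (l := s) (l' := 1 :: t))
  have h' := hr.induction_of_shift (fun _ _ => APlus.shift) h
  rcases List.eq_nil_or_concat (t ++ s) with e | ⟨u, c, e⟩
  · rw [e] at h'
    simpa [eta] using congrFun (congrFun h'.2.2.1 1) 0
  · have hr' : s ++ 1 :: t ~r c :: 1 :: u := by
      rw [e] at hr
      refine hr.trans ?_
      simpa using (List.isRotated_append (l := 1 :: u) (l' := [c]))
    cases u with
    | cons d r => exact ⟨c, d, r, hr'⟩
    | nil =>
      have h'' := hr'.induction_of_shift (fun _ _ => APlus.shift) h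
      simpa [eta] using congrFun (congrFun h''.2.2.1 1) 0

/-- Inverse of the insertion rule. -/
lemma APlus.of_insert {a b x : ℤ} {l : List ℤ}
    (h : APlus ((a + 1) :: 1 :: (b + 1) :: x :: l)) : APlus (a :: b :: x :: l) := by
  obtain ⟨-, hpos, hprod, hnn⟩ := h
  have h3 := hnn 3 (by simp)
  simp only [List.take_succ_cons, List.take_zero, prod_map_eta_insert] at h3
  simp only [List.map_cons, List.map_nil, List.prod_cons, List.prod_nil, mul_one,
    eta_mul_apply_zero_zero, eta_mul_apply_one] at h3
  simp only [eta, Matrix.of_apply, Matrix.cons_val', Matrix.cons_val_zero, Matrix.cons_val_one,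
      Matrix.cons_val_fin_one] at h3
  simp only [List.mem_cons, forall_eq_or_imp] at hpos
  obtain ⟨ha, -, hb, hx, hl⟩ := hpos
  have ha' : 1 ≤ a := by
    by_contra! hlt
    obtain rfl : a = 0 := by omega
    omega
  refine ⟨by simp, ?_, (prod_map_eta_insert a b _).symm.trans hprod, fun i hi => ?_⟩
  · simp only [List.mem_cons, forall_eq_or_imp]
    exact ⟨ha', by nlinarith, hx, hl⟩
  · match i with
    | 0 => simp
    | 1 => simp [eta]; omega
    | i + 2 =>
      have := hnn (i + 3) (by simpa using hi)
      simp only [List.take_succ_cons] at this ⊢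
      rwa [prod_map_eta_insert] at this

lemma APlus.eq_one_of_triple {c d : ℤ} (h : APlus [c, 1, d]) : c = 1 ∧ d = 1 := by
  have h10 := congrFun (congrFun h.2.2.1 1) 0
  have h01 := congrFun (congrFun h.2.2.1 0) 1
  simp [eta, Matrix.mul_apply, Fin.sum_univ_two] at h10 h01
  constructor <;> omega

lemma APlus.isEtaSeq {l : List ℤ} (h : APlus l) : IsEtaSeq l := by
  induction hn : l.length using Nat.strong_induction_on generalizing l with
  | _ n ih =>
    obtain ⟨c, d, r, hr⟩ := h.exists_isRotated
    have h' := hr.induction_of_shift (fun _ _ => APlus.shift) h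
    refine hr.symm.induction_of_shift IsEtaSeq.shift ?_
    cases r with
    | nil =>
      obtain ⟨rfl, rfl⟩ := h'.eq_one_of_triple
      exact .base
    | cons x r =>
      obtain ⟨a, rfl⟩ : ∃ a, c = a + 1 := ⟨c - 1, by ring⟩
      obtain ⟨b, rfl⟩ : ∃ b, d = b + 1 := ⟨d - 1, by ring⟩
      have hlen := hr.perm.length_eq
      simp only [List.length_cons] at hlen
      exact .insert a b _ (ih _ (by simp only [List.length_cons]; omega) h'.of_insert rfl)

/-- A finite sequence of integers is an η-sequence if and only if it belongs to `𝒜⁺`. -/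
theorem stmt_1 (l : List ℤ) : IsEtaSeq l ↔ APlus l :=
  ⟨IsEtaSeq.aPlus, APlus.isEtaSeq⟩
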